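/- Let α > 0 and 0 ≤ λ < α. If φ ∈ 𝔐_{2λ}, then for every x ∈ ℚ_p⁴, lim_{t → 0⁺} ∫_{ℚ_p⁴} Z(x − ξ, t) φ(ξ) d⁴ξ = φ(x). -/

import Mathlib

open MeasureTheory Real Filter Set

noncomputable section

namespace PadicParabolic

variable (p : ℕ) [Fact p.Prime]

instance : MeasurableSpace ℚ_[p] := borel _
instance : BorelSpace ℚ_[p] := ⟨rfl⟩

/-- The four dimensional vector space over `ℚ_[p]`, with the max-norm
`‖x‖ = max_{1 ≤ i ≤ 4} |x_i|_p`. -/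
abbrev V (p : ℕ) [Fact p.Prime] := Fin 4 → ℚ_[p]

/-- `a` is a quadratic non-residue modulo `p`. -/
def IsQNR (a : ℤ) : Prop := ∀ b : ZMod p, b ^ 2 ≠ (a : ZMod p)

/-- The elliptic quadratic form `f(x) = x₁² − a x₂² − p x₃² + a p x₄²`. -/
def qf (a : ℤ) (x : V p) : ℚ_[p] :=
  x 0 ^ 2 - (a : ℚ_[p]) * x 1 ^ 2 - (p : ℚ_[p]) * x 2 ^ 2 + (a : ℚ_[p]) * (p : ℚ_[p]) * x 3 ^ 2

/-- The dual elliptic quadratic form `f°(ξ) = a p ξ₁² − p ξ₂² − a ξ₃² + ξ₄²`. -/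
def qfc (a : ℤ) (x : V p) : ℚ_[p] :=
  (a : ℚ_[p]) * (p : ℚ_[p]) * x 0 ^ 2 - (p : ℚ_[p]) * x 1 ^ 2 - (a : ℚ_[p]) * x 2 ^ 2 + x 3 ^ 2

/-- `χ` is the standard additive character `χ(y) = exp(2πi {y}_p)` of `ℚ_p`, characterized as
the unique continuous function with `χ(m/pⁿ) = exp(2πi m/pⁿ)`. -/
def IsStdChar (χ : ℚ_[p] → ℂ) : Prop :=
  Continuous χ ∧ ∀ (m : ℤ) (n : ℕ),
    χ ((m : ℚ_[p]) / (p : ℚ_[p]) ^ n) =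
      Complex.exp (2 * (Real.pi : ℂ) * Complex.I * (m : ℂ) / (p : ℂ) ^ n)

/-- The heat kernel `Z(x,t) = ∫_{ℚ_p⁴} χ(ξ·x) e^{−κ t |f°(ξ)|_p^α} d⁴ξ`. -/
def heatZ (μ : Measure (V p)) (χ : ℚ_[p] → ℂ) (a : ℤ) (κ α : ℝ) (x : V p) (t : ℝ) : ℂ :=
  ∫ ξ, χ (∑ i, ξ i * x i) * (Real.exp (-(κ * t * ‖qfc p a ξ‖ ^ α)) : ℂ) ∂μ

/-- The space `𝔐_λ` of locally constant functions `φ : ℚ_p⁴ → ℂ` with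
`|φ(x)| ≤ C (1 + ‖x‖_p^λ)` for some constant `C`. -/
def Mlam (lam : ℝ) (φ : V p → ℂ) : Prop :=
  IsLocallyConstant φ ∧ ∃ C : ℝ, ∀ x : V p, ‖φ x‖ ≤ C * (1 + ‖x‖ ^ lam)

section
variable {p}

lemma prime_cast_pos : (0 : ℝ) < p := by exact_mod_cast (Fact.out : p.Prime).pos
lemma one_lt_prime_cast : (1 : ℝ) < p := by exact_mod_cast (Fact.out : p.Prime).one_lt

/-- The max-norm on `V p` is attained at some coordinate. -/
lemma exists_norm_eq_norm_apply (x : V p) : ∃ i, ‖x‖ = ‖x i‖ := by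
  obtain ⟨i, hi⟩ := Finite.exists_max fun i => ‖x i‖
  exact ⟨i, le_antisymm ((pi_norm_le_iff_of_nonneg (norm_nonneg _)).2 hi) (norm_le_pi_norm x i)⟩

section StdChar
variable {χ : ℚ_[p] → ℂ}

/-- The elements `m / pⁿ` are dense in `ℚ_[p]`. -/
lemma denseRange_intCast_div_pow :
    DenseRange fun q : ℤ × ℕ => (q.1 : ℚ_[p]) / (p : ℚ_[p]) ^ q.2 := by
  intro y
  rw [Metric.mem_closure_range_iff]
  intro ε hε
  have hp0 : (p : ℚ_[p]) ≠ 0 := by exact_mod_cast (Fact.out : p.Prime).ne_zero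
  obtain ⟨n, hn⟩ := pow_unbounded_of_one_lt ‖y‖ (one_lt_prime_cast (p := p))
  have hy : ‖y * (p : ℚ_[p]) ^ n‖ ≤ 1 := by
    have := pow_pos (prime_cast_pos (p := p)) n
    rw [norm_mul, norm_pow, Padic.norm_p, inv_pow, ← div_eq_mul_inv, div_le_one this]
    exact hn.le
  have hpn : 0 < ‖((p : ℚ_[p]) ^ n)‖ := norm_pos_iff.2 (pow_ne_zero n hp0)
  obtain ⟨z, hz⟩ : ∃ z : ℤ_[p], (z : ℚ_[p]) = y * (p : ℚ_[p]) ^ n := ⟨⟨_, hy⟩, rfl⟩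
  obtain ⟨m, hm⟩ := Metric.denseRange_iff.1 PadicInt.denseRange_intCast z _ (mul_pos hε hpn)
  refine ⟨(m, n), ?_⟩
  have hm' : ‖y * (p : ℚ_[p]) ^ n - m‖ < ε * ‖((p : ℚ_[p]) ^ n)‖ := by
    rw [dist_eq_norm, PadicInt.norm_def, PadicInt.coe_sub, PadicInt.coe_intCast, hz] at hm
    exact hm
  have : y - (m : ℚ_[p]) / (p : ℚ_[p]) ^ n = (y * (p : ℚ_[p]) ^ n - m) / (p : ℚ_[p]) ^ n := by
    field_simp
  rw [dist_eq_norm, this, norm_div, div_lt_iff₀ hpn]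
  exact hm'

lemma IsStdChar.map_add (hχ : IsStdChar p χ) (y z : ℚ_[p]) : χ (y + z) = χ y * χ z := by
  have hp0 : (p : ℚ_[p]) ≠ 0 := by exact_mod_cast (Fact.out : p.Prime).ne_zero
  have hp1 : (p : ℂ) ≠ 0 := by exact_mod_cast (Fact.out : p.Prime).ne_zero
  have hc := hχ.1
  refine denseRange_intCast_div_pow.induction_on₂
    (p := fun y z => χ (y + z) = χ y * χ z)
    (isClosed_eq (by fun_prop) (by fun_prop)) ?_ y z
  rintro ⟨m, n⟩ ⟨k, l⟩
  have h : (m : ℚ_[p]) / (p : ℚ_[p]) ^ n + (k : ℚ_[p]) / (p : ℚ_[p]) ^ l =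
      ((m * (p : ℤ) ^ l + k * (p : ℤ) ^ n : ℤ) : ℚ_[p]) / (p : ℚ_[p]) ^ (n + l) := by
    push_cast
    field_simp
    ring
  simp only [h, hχ.2, ← Complex.exp_add]
  congr 1
  push_cast
  field_simp
  ring

lemma IsStdChar.norm_eq_one (hχ : IsStdChar p χ) (y : ℚ_[p]) : ‖χ y‖ = 1 := by
  have hc := hχ.1
  refine denseRange_intCast_div_pow.induction_on (p := fun y => ‖χ y‖ = 1) y
    (isClosed_eq (by fun_prop) (by fun_prop)) ?_
  rintro ⟨m, n⟩
  have h : 2 * (Real.pi : ℂ) * Complex.I * (m : ℂ) / (p : ℂ) ^ n =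
      ((2 * Real.pi * m / (p : ℝ) ^ n : ℝ) : ℂ) * Complex.I := by
    push_cast; ring
  simp only [hχ.2, h, Complex.norm_exp_ofReal_mul_I]

lemma IsStdChar.eq_one_of_norm_le_one (hχ : IsStdChar p χ) {y : ℚ_[p]} (hy : ‖y‖ ≤ 1) :
    χ y = 1 := by
  have hc := hχ.1
  refine PadicInt.denseRange_intCast.induction_on (p := fun z : ℤ_[p] => χ z = 1) ⟨y, hy⟩
    (isClosed_eq (by fun_prop) (by fun_prop)) ?_
  intro m
  have := hχ.2 m 0
  simp only [pow_zero, div_one] at this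
  rw [PadicInt.coe_intCast, this, Complex.exp_eq_one_iff]
  exact ⟨m, by ring⟩

lemma IsStdChar.inv_prime_ne_one (hχ : IsStdChar p χ) : χ ((p : ℚ_[p])⁻¹) ≠ 1 := by
  have h := hχ.2 1 1
  simp only [Int.cast_one, pow_one, mul_one, one_div] at h
  rw [h]
  exact (Complex.isPrimitiveRoot_exp p (Fact.out : p.Prime).ne_zero).ne_one
    (Fact.out : p.Prime).one_lt

end StdChar

section Form
variable {a : ℤ}

/-- The form `u² - a v²` is anisotropic modulo `p` when `a` is a non-residue. -/
lemma IsQNR.norm_sq_sub (ha : IsQNR p a) (u v : ℚ_[p]) :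
    ‖u ^ 2 - (a : ℚ_[p]) * v ^ 2‖ = max ‖u‖ ‖v‖ ^ 2 := by
  have ha1 : ‖(a : ℚ_[p])‖ = 1 := by
    refine le_antisymm (Padic.norm_int_le_one a) (not_lt.1 fun h => ha 0 ?_)
    rw [Padic.norm_intCast_lt_one_iff] at h
    rw [(ZMod.intCast_zmod_eq_zero_iff_dvd a p).2 h]; ring
  by_cases huv : ‖u‖ = ‖v‖
  · by_cases hv : v = 0
    · subst hv; simp [huv]
    have hw : ‖u / v‖ ≤ 1 := by rw [norm_div, huv, div_self (norm_ne_zero_iff.2 hv)]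
    set w : ℤ_[p] := ⟨u / v, hw⟩ with hwdef
    have hw1 : ‖w ^ 2 - (a : ℤ_[p])‖ = 1 := by
      refine le_antisymm (PadicInt.norm_le_one _) (not_lt.1 fun h => ha (PadicInt.toZMod w) ?_)
      have : w ^ 2 - (a : ℤ_[p]) ∈ RingHom.ker (PadicInt.toZMod (p := p)) := by
        rw [PadicInt.ker_toZMod, IsLocalRing.mem_maximalIdeal, PadicInt.mem_nonunits]
        exact h
      rw [RingHom.mem_ker, map_sub, map_pow, map_intCast, sub_eq_zero] at this
      exact this
    have : u ^ 2 - (a : ℚ_[p]) * v ^ 2 = (w ^ 2 - (a : ℤ_[p]) : ℤ_[p]) * v ^ 2 := by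
      push_cast
      rw [hwdef]
      field_simp
    rw [this, norm_mul, ← PadicInt.norm_def, hw1, huv, max_self, norm_pow, one_mul]
  · have hne : ‖u ^ 2‖ ≠ ‖-((a : ℚ_[p]) * v ^ 2)‖ := by
      rw [norm_neg, norm_mul, ha1, one_mul, norm_pow, norm_pow]
      exact fun h => huv ((pow_left_inj₀ (norm_nonneg _) (norm_nonneg _) two_ne_zero).1 h)
    rw [sub_eq_add_neg, Padic.add_eq_max_of_ne hne, norm_neg, norm_mul, ha1, one_mul, norm_pow,
      norm_pow]
    rcases le_total ‖u‖ ‖v‖ with h | h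
    · rw [max_eq_right h, max_eq_right (by gcongr)]
    · rw [max_eq_left h, max_eq_left (by gcongr)]

lemma IsQNR.norm_qfc (ha : IsQNR p a) (ξ : V p) :
    ‖qfc p a ξ‖ = max (max ‖ξ 3‖ ‖ξ 2‖ ^ 2) ((p : ℝ)⁻¹ * max ‖ξ 1‖ ‖ξ 0‖ ^ 2) := by
  have hp := one_lt_prime_cast (p := p)
  have h : qfc p a ξ = (ξ 3 ^ 2 - (a : ℚ_[p]) * ξ 2 ^ 2) +
      -((p : ℚ_[p]) * (ξ 1 ^ 2 - (a : ℚ_[p]) * ξ 0 ^ 2)) := by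
    unfold qfc; ring
  have hA := ha.norm_sq_sub (ξ 3) (ξ 2)
  have hB : ‖-((p : ℚ_[p]) * (ξ 1 ^ 2 - (a : ℚ_[p]) * ξ 0 ^ 2))‖ =
      (p : ℝ)⁻¹ * max ‖ξ 1‖ ‖ξ 0‖ ^ 2 := by
    rw [norm_neg, norm_mul, Padic.norm_p, ha.norm_sq_sub]
  have key : ∀ u v : ℚ_[p], ∃ w : ℚ_[p], max ‖u‖ ‖v‖ = ‖w‖ := fun u v =>
    (max_choice ‖u‖ ‖v‖).elim (fun h => ⟨u, h⟩) (fun h => ⟨v, h⟩)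
  obtain ⟨u, hu⟩ := key (ξ 3) (ξ 2)
  obtain ⟨v, hv⟩ := key (ξ 1) (ξ 0)
  rw [h]
  rw [hu] at hA ⊢
  rw [hv] at hB ⊢
  by_cases hne : ‖u‖ ^ 2 = (p : ℝ)⁻¹ * ‖v‖ ^ 2
  · have hv0 : v = 0 := by
      by_contra hv0
      have hu0 : u ≠ 0 := by
        rintro rfl
        have : 0 < (p : ℝ)⁻¹ * ‖v‖ ^ 2 := by positivity
        rw [← hne] at this
        simp at this
      rw [Padic.norm_eq_zpow_neg_valuation hu0, Padic.norm_eq_zpow_neg_valuation hv0,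
        ← zpow_neg_one, ← zpow_natCast, ← zpow_natCast, ← zpow_mul, ← zpow_mul,
        ← zpow_add₀ (by positivity)] at hne
      have := zpow_right_injective₀ (by positivity) hp.ne' hne
      push_cast at this
      omega
    have hu0 : u = 0 := by subst hv0; simpa using hne
    subst hv0 hu0
    simp only [norm_zero, ne_eq, OfNat.ofNat_ne_zero, not_false_eq_true, zero_pow, mul_zero,
      norm_eq_zero] at hA hB
    simp [hA, hB]
  · rw [Padic.add_eq_max_of_ne (by rw [hA, hB]; exact hne), hA, hB]

lemma IsQNR.norm_qfc_le (ha : IsQNR p a) (ξ : V p) : ‖qfc p a ξ‖ ≤ ‖ξ‖ ^ 2 := by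
  have hp := one_lt_prime_cast (p := p)
  have h (i) : ‖ξ i‖ ≤ ‖ξ‖ := norm_le_pi_norm ξ i
  rw [ha.norm_qfc]
  refine max_le (by gcongr; exact max_le (h _) (h _)) ?_
  calc (p : ℝ)⁻¹ * max ‖ξ 1‖ ‖ξ 0‖ ^ 2 ≤ 1 * ‖ξ‖ ^ 2 := by
        gcongr
        · exact inv_le_one_of_one_le₀ hp.le
        · exact max_le (h _) (h _)
    _ = _ := one_mul _

lemma IsQNR.sq_norm_le (ha : IsQNR p a) (ξ : V p) : ‖ξ‖ ^ 2 ≤ p * ‖qfc p a ξ‖ := by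
  have hp := one_lt_prime_cast (p := p)
  have hp0 := prime_cast_pos (p := p)
  obtain ⟨i, hi⟩ := exists_norm_eq_norm_apply ξ
  have h1 : max ‖ξ 3‖ ‖ξ 2‖ ^ 2 ≤ p * ‖qfc p a ξ‖ := by
    rw [ha.norm_qfc]
    refine (le_max_left _ _).trans (le_mul_of_one_le_left ?_ hp.le)
    positivity
  have h2 : max ‖ξ 1‖ ‖ξ 0‖ ^ 2 ≤ p * ‖qfc p a ξ‖ := by
    rw [ha.norm_qfc]
    calc _ = p * ((p : ℝ)⁻¹ * max ‖ξ 1‖ ‖ξ 0‖ ^ 2) := by field_simp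
      _ ≤ _ := by gcongr; exact le_max_right _ _
  rw [hi]
  fin_cases i
  · exact (pow_le_pow_left₀ (norm_nonneg _) (le_max_right _ _) 2).trans h2
  · exact (pow_le_pow_left₀ (norm_nonneg _) (le_max_left _ _) 2).trans h2
  · exact (pow_le_pow_left₀ (norm_nonneg _) (le_max_right _ _) 2).trans h1
  · exact (pow_le_pow_left₀ (norm_nonneg _) (le_max_left _ _) 2).trans h1

lemma IsQNR.norm_qfc_add_le (ha : IsQNR p a) (ξ η : V p) :
    ‖qfc p a (ξ + η)‖ ≤ max ‖qfc p a ξ‖ ‖qfc p a η‖ := by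
  have key : ∀ i j, max ‖(ξ + η) i‖ ‖(ξ + η) j‖ ^ 2 ≤
      max (max ‖ξ i‖ ‖ξ j‖ ^ 2) (max ‖η i‖ ‖η j‖ ^ 2) := by
    intro i j
    have h : max ‖(ξ + η) i‖ ‖(ξ + η) j‖ ≤ max (max ‖ξ i‖ ‖ξ j‖) (max ‖η i‖ ‖η j‖) := by
      refine max_le ?_ ?_
      · exact (Padic.nonarchimedean _ _).trans
          (max_le_max (le_max_left _ _) (le_max_left _ _))
      · exact (Padic.nonarchimedean _ _).trans
          (max_le_max (le_max_right _ _) (le_max_right _ _))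
    rcases le_max_iff.1 h with h | h
    · exact le_max_of_le_left (by gcongr)
    · exact le_max_of_le_right (by gcongr)
  rw [ha.norm_qfc, ha.norm_qfc, ha.norm_qfc]
  rcases le_max_iff.1 (key 3 2) with h1 | h1 <;> rcases le_max_iff.1 (key 1 0) with h2 | h2 <;>
  refine max_le ?_ ?_ <;> simp only [le_max_iff]
  all_goals first
    | exact Or.inl (Or.inl h1)
    | exact Or.inr (Or.inl h1)
    | exact Or.inl (Or.inr (mul_le_mul_of_nonneg_left h2 (by positivity)))
    | exact Or.inr (Or.inr (mul_le_mul_of_nonneg_left h2 (by positivity)))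

lemma qfc_neg (ξ : V p) : qfc p a (-ξ) = qfc p a ξ := by
  simp [qfc]

lemma continuous_qfc : Continuous (qfc p a) := by
  unfold qfc; fun_prop

end Form

end

section
variable {p}
variable {μ : Measure (V p)} [μ.IsAddHaarMeasure] {χ : ℚ_[p] → ℂ}

open Metric

/-- The Haar measure of the balls of `V p` is a geometric progression. -/
lemma exists_measure_closedBall_eq (hμ : μ {x : V p | ‖x‖ ≤ 1} = 1) :
    ∃ c : ℝ, 0 < c ∧ ∀ k : ℤ, μ.real (closedBall (0 : V p) ((p : ℝ) ^ k)) = c ^ k := by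
  have hp0 : (p : ℚ_[p]) ≠ 0 := by exact_mod_cast (Fact.out : p.Prime).ne_zero
  have hp1 := prime_cast_pos (p := p)
  let e : V p ≃ₜ+ V p :=
    { DistribMulAction.toAddEquiv₀ (V p) (p : ℚ_[p]) hp0 with
      continuous_toFun := continuous_const_smul (p : ℚ_[p])
      continuous_invFun := continuous_const_smul (p : ℚ_[p])⁻¹ }
  have he (x : V p) : e x = (p : ℚ_[p]) • x := rfl
  set d : NNReal := addEquivAddHaarChar e
  have hd : 0 < (d : ℝ) := addEquivAddHaarChar_pos e
  have hstep (k : ℤ) : μ.real (closedBall (0 : V p) ((p : ℝ) ^ (k + 1))) =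
      (d : ℝ)⁻¹ * μ.real (closedBall (0 : V p) ((p : ℝ) ^ k)) := by
    have hpre : e ⁻¹' closedBall (0 : V p) ((p : ℝ) ^ k) =
        closedBall (0 : V p) ((p : ℝ) ^ (k + 1)) := by
      ext x
      simp only [mem_preimage, mem_closedBall_zero_iff, he, norm_smul, Padic.norm_p]
      rw [inv_mul_le_iff₀ hp1, zpow_add_one₀ hp1.ne', mul_comm]
    have := addEquivAddHaarChar_smul_preimage μ (X := closedBall (0 : V p) ((p : ℝ) ^ k)) e
    rw [hpre] at this
    rw [eq_inv_mul_iff_mul_eq₀ hd.ne', measureReal_def, measureReal_def, ← this,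
      ENNReal.toReal_smul, NNReal.smul_def, smul_eq_mul]
  have h0 : μ.real (closedBall (0 : V p) ((p : ℝ) ^ (0 : ℤ))) = 1 := by
    have : closedBall (0 : V p) ((p : ℝ) ^ (0 : ℤ)) = {x : V p | ‖x‖ ≤ 1} := by
      ext x; simp
    rw [this, measureReal_def, hμ]; rfl
  refine ⟨(d : ℝ)⁻¹, by positivity, fun k => ?_⟩
  induction k using Int.induction_on with
  | zero => rw [h0, zpow_zero]
  | succ k ih => rw [hstep, ih, zpow_add_one₀ (by positivity), mul_comm]
  | pred k ih =>
    have := hstep (-(k : ℤ) - 1)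
    rw [sub_add_cancel, ih, eq_inv_mul_iff_mul_eq₀ hd.ne'] at this
    rw [← this, zpow_sub_one₀ (by positivity), inv_inv, mul_comm]

lemma continuous_char_dot (hχ : IsStdChar p χ) :
    Continuous fun q : V p × V p => χ (∑ i, q.1 i * q.2 i) := by
  have := hχ.1
  fun_prop

lemma char_dot_add (hχ : IsStdChar p χ) (ξ η x : V p) :
    χ (∑ i, (ξ + η) i * x i) = χ (∑ i, ξ i * x i) * χ (∑ i, η i * x i) := by
  simp only [← hχ.map_add, ← Finset.sum_add_distrib, Pi.add_apply, add_mul]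

lemma char_dot_eq_one (hχ : IsStdChar p χ) {ξ x : V p} (h : ‖ξ‖ * ‖x‖ ≤ 1) :
    χ (∑ i, ξ i * x i) = 1 := by
  refine hχ.eq_one_of_norm_le_one ?_
  refine IsUltrametricDist.norm_sum_le_of_forall_le_of_nonneg zero_le_one fun i _ => ?_
  rw [norm_mul]
  exact le_trans (by gcongr <;> exact norm_le_pi_norm _ i) h

lemma exists_char_dot_ne_one (hχ : IsStdChar p χ) {x : V p} (hx : x ≠ 0) :
    ∃ ξ : V p, ‖ξ‖ = p / ‖x‖ ∧ χ (∑ i, ξ i * x i) ≠ 1 := by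
  obtain ⟨i, hi⟩ := exists_norm_eq_norm_apply x
  have hxi : x i ≠ 0 := by
    rw [← norm_ne_zero_iff, ← hi]; exact norm_ne_zero_iff.2 hx
  refine ⟨Pi.single i ((p : ℚ_[p])⁻¹ * (x i)⁻¹), ?_, ?_⟩
  · rw [Pi.norm_single, norm_mul, norm_inv, norm_inv, Padic.norm_p, inv_inv, hi, div_eq_mul_inv]
  · have : ∑ j, (Pi.single i ((p : ℚ_[p])⁻¹ * (x i)⁻¹) : V p) j * x j = (p : ℚ_[p])⁻¹ := by
      rw [Finset.sum_eq_single i]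
      · simp [hxi]
      · intro j _ hj; simp [Pi.single_eq_of_ne hj]
      · simp
    rw [this]
    exact hχ.inv_prime_ne_one

/-- The Fourier transform of the indicator of a set `S`. -/
def charIntegral (μ : Measure (V p)) (χ : ℚ_[p] → ℂ) (S : Set (V p)) (x : V p) : ℂ :=
  ∫ ξ in S, χ (∑ i, ξ i * x i) ∂μ

lemma charIntegral_of_forall {S : Set (V p)} {x : V p}
    (h : ∀ ξ ∈ S, χ (∑ i, ξ i * x i) = 1) (hS : MeasurableSet S) :
    charIntegral μ χ S x = (μ.real S : ℂ) := by
  rw [charIntegral, setIntegral_congr_fun hS h]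
  simp

lemma charIntegral_eq_zero (hχ : IsStdChar p χ) {S : Set (V p)} (hS : MeasurableSet S)
    {x η : V p} (hη : ∀ ξ, η + ξ ∈ S ↔ ξ ∈ S) (h : χ (∑ i, η i * x i) ≠ 1) :
    charIntegral μ χ S x = 0 := by
  have key : charIntegral μ χ S x = χ (∑ i, η i * x i) * charIntegral μ χ S x := by
    conv_lhs => rw [charIntegral, ← integral_indicator hS, ← integral_add_left_eq_self _ η]
    rw [charIntegral, ← integral_indicator hS, ← integral_const_mul]
    congr 1 with ξ
    by_cases hξ : ξ ∈ S
    · rw [indicator_of_mem ((hη ξ).2 hξ), indicator_of_mem hξ, char_dot_add hχ]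
    · rw [indicator_of_notMem (mt (hη ξ).1 hξ), indicator_of_notMem hξ, mul_zero]
  have : (1 - χ (∑ i, η i * x i)) * charIntegral μ χ S x = 0 := by
    rw [sub_mul, one_mul, ← key, sub_self]
  exact (mul_eq_zero.1 this).resolve_left (sub_ne_zero.2 h.symm)

/-- `charIntegral` takes nonnegative real values when `S` is a subgroup. -/
lemma ofReal_norm_charIntegral (hχ : IsStdChar p χ) {S : Set (V p)} (hS : MeasurableSet S)
    (hadd : ∀ η ∈ S, ∀ ξ, η + ξ ∈ S ↔ ξ ∈ S) (x : V p) :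
    (‖charIntegral μ χ S x‖ : ℂ) = charIntegral μ χ S x := by
  by_cases h : ∀ ξ ∈ S, χ (∑ i, ξ i * x i) = 1
  · rw [charIntegral_of_forall h hS]
    simp
  · push Not at h
    obtain ⟨η, hη, hne⟩ := h
    rw [charIntegral_eq_zero hχ hS (hadd η hη) hne]
    simp

lemma charIntegral_eq_zero_of_le (hχ : IsStdChar p χ) {S : Set (V p)} (hS : MeasurableSet S)
    (hadd : ∀ η ∈ S, ∀ ξ, η + ξ ∈ S ↔ ξ ∈ S) {R : ℝ} (hR : 0 < R)
    (hRS : closedBall 0 R ⊆ S) {x : V p} (hx : p / R ≤ ‖x‖) :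
    charIntegral μ χ S x = 0 := by
  have hx0 : 0 < ‖x‖ := (div_pos prime_cast_pos hR).trans_le hx
  obtain ⟨η, hη, hne⟩ := exists_char_dot_ne_one hχ (norm_pos_iff.1 hx0)
  refine charIntegral_eq_zero hχ hS (hadd η (hRS ?_)) hne
  rw [mem_closedBall_zero_iff, hη]
  rw [div_le_iff₀ hR] at hx
  rw [div_le_iff₀ hx0]
  linarith

lemma add_mem_closedBall_iff {r : ℝ} (η : V p) (hη : η ∈ closedBall (0 : V p) r) (ξ : V p) :
    η + ξ ∈ closedBall (0 : V p) r ↔ ξ ∈ closedBall (0 : V p) r := by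
  simp only [mem_closedBall_zero_iff] at *
  refine ⟨fun h => ?_, fun h => (IsUltrametricDist.norm_add_le_max η ξ).trans (max_le hη h)⟩
  have := (IsUltrametricDist.norm_add_le_max (-η) (η + ξ)).trans (max_le (by simpa using hη) h)
  simpa using this

/-- The Fourier inversion formula at the origin for the indicator of a lattice. -/
lemma integral_charIntegral (hμ : μ {x : V p | ‖x‖ ≤ 1} = 1) (hχ : IsStdChar p χ)
    {S : Set (V p)} (hS : MeasurableSet S) (hadd : ∀ η ∈ S, ∀ ξ, η + ξ ∈ S ↔ ξ ∈ S)
    {R : ℝ} (hR : 0 < R) (hRS : closedBall 0 R ⊆ S) (hSfin : μ S ≠ ⊤) :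
    ∫ x, charIntegral μ χ S x ∂μ = 1 := by
  have hp1 := prime_cast_pos (p := p)
  obtain ⟨c, hc, hball⟩ := exists_measure_closedBall_eq hμ
  obtain ⟨k, hk⟩ := pow_unbounded_of_one_lt (p / R) (one_lt_prime_cast (p := p))
  set B := closedBall (0 : V p) ((p : ℝ) ^ (k : ℤ)) with hB
  set B' := closedBall (0 : V p) ((p : ℝ) ^ (-k : ℤ)) with hB'
  have hBm : MeasurableSet B := isClosed_closedBall.measurableSet
  have hBm' : MeasurableSet B' := isClosed_closedBall.measurableSet
  have hpk : (0 : ℝ) < (p : ℝ) ^ k := by positivity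
  have hB'S : B' ⊆ S := by
    refine (closedBall_subset_closedBall ?_).trans hRS
    rw [zpow_neg, zpow_natCast, inv_le_comm₀ hpk hR]
    refine le_trans ?_ hk.le
    rw [inv_eq_one_div]
    gcongr
    exact one_lt_prime_cast.le
  have hBfin : μ B ≠ ⊤ := (isCompact_closedBall _ _).measure_ne_top
  have h1 : ∫ x, charIntegral μ χ S x ∂μ = ∫ x in B, charIntegral μ χ S x ∂μ := by
    refine (setIntegral_eq_integral_of_forall_compl_eq_zero fun x hx => ?_).symm
    refine charIntegral_eq_zero_of_le hχ hS hadd hR hRS ?_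
    rw [hB, mem_closedBall_zero_iff, not_le, zpow_natCast] at hx
    exact (hk.trans hx).le
  have h2 : ∫ x in B, charIntegral μ χ S x ∂μ = ∫ ξ in S, charIntegral μ χ B ξ ∂μ := by
    unfold charIntegral
    rw [integral_integral_swap]
    · simp only [mul_comm]
    · have : IsFiniteMeasure (μ.restrict B) := ⟨by simpa using hBfin.lt_top⟩
      have : IsFiniteMeasure (μ.restrict S) := ⟨by simpa using hSfin.lt_top⟩
      refine Integrable.of_bound (C := 1) ?_ (ae_of_all _ fun q => (hχ.norm_eq_one _).le)
      exact ((continuous_char_dot hχ).comp continuous_swap).aestronglyMeasurable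
  have h3 : ∀ ξ, charIntegral μ χ B ξ = B'.indicator (fun _ => (μ.real B : ℂ)) ξ := by
    intro ξ
    by_cases hξ : ξ ∈ B'
    · rw [indicator_of_mem hξ]
      refine charIntegral_of_forall (fun η hη => char_dot_eq_one hχ ?_) hBm
      rw [hB', mem_closedBall_zero_iff] at hξ
      rw [hB, mem_closedBall_zero_iff] at hη
      calc ‖η‖ * ‖ξ‖ ≤ (p : ℝ) ^ (k : ℤ) * (p : ℝ) ^ (-k : ℤ) := by gcongr
        _ = 1 := by rw [← zpow_add₀ hp1.ne']; simp
    · rw [indicator_of_notMem hξ]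
      have hξ0 : ξ ≠ 0 := by
        rintro rfl
        exact hξ (mem_closedBall_self (by positivity))
      obtain ⟨η, hη, hne⟩ := exists_char_dot_ne_one hχ hξ0
      refine charIntegral_eq_zero hχ hBm (add_mem_closedBall_iff η ?_) hne
      rw [mem_closedBall_zero_iff, hη]
      obtain ⟨n, hn⟩ : ∃ n : ℤ, ‖ξ‖ = (p : ℝ) ^ n := by
        obtain ⟨i, hi⟩ := exists_norm_eq_norm_apply ξ
        have : ξ i ≠ 0 := by
          rw [← norm_ne_zero_iff, ← hi]; exact norm_ne_zero_iff.2 hξ0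
        exact ⟨_, hi.trans (Padic.norm_eq_zpow_neg_valuation this)⟩
      rw [hB', mem_closedBall_zero_iff, not_le, hn, zpow_lt_zpow_iff_right₀ one_lt_prime_cast] at hξ
      rw [hn]
      calc (p : ℝ) / (p : ℝ) ^ n = (p : ℝ) ^ (1 - n) := by rw [zpow_sub₀ hp1.ne', zpow_one]
        _ ≤ (p : ℝ) ^ (k : ℤ) := zpow_le_zpow_right₀ one_lt_prime_cast.le (by omega)
  rw [h1, h2]
  simp only [h3]
  rw [setIntegral_indicator hBm', inter_eq_right.2 hB'S, setIntegral_const, hB, hB', hball, hball,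
    Complex.real_smul, ← Complex.ofReal_mul, ← zpow_add₀ hc.ne']
  simp

end

section
variable {p} {a : ℤ} {α : ℝ}
variable {μ : Measure (V p)} [μ.IsAddHaarMeasure] {χ : ℚ_[p] → ℂ}

open Metric

lemma exists_measure_closedBall_le (hμ : μ {x : V p | ‖x‖ ≤ 1} = 1) :
    ∃ (C : ℝ) (n : ℕ), 0 ≤ C ∧
      ∀ r : ℝ, 1 ≤ r → μ.real (closedBall (0 : V p) r) ≤ C * r ^ n := by
  have hp1 := one_lt_prime_cast (p := p)
  have hp0 := prime_cast_pos (p := p)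
  obtain ⟨c, hc, hball⟩ := exists_measure_closedBall_eq hμ
  obtain ⟨n, hn⟩ := pow_unbounded_of_one_lt c hp1
  refine ⟨(p : ℝ) ^ n, n, by positivity, fun r hr => ?_⟩
  obtain ⟨k, hk, hk'⟩ := exists_nat_pow_near hr hp1
  calc μ.real (closedBall (0 : V p) r)
      ≤ μ.real (closedBall (0 : V p) ((p : ℝ) ^ ((k + 1 : ℕ) : ℤ))) :=
        measureReal_mono (closedBall_subset_closedBall (by rw [zpow_natCast]; exact hk'.le))
          (isCompact_closedBall _ _).measure_ne_top
    _ = c ^ (k + 1) := by rw [hball, zpow_natCast]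
    _ ≤ ((p : ℝ) ^ n) ^ (k + 1) := by gcongr
    _ = (p : ℝ) ^ n * ((p : ℝ) ^ k) ^ n := by ring
    _ ≤ (p : ℝ) ^ n * r ^ n := by gcongr

/-- The sublevel sets of `|f°|_p ^ α`. -/
def sublevel (a : ℤ) (α s : ℝ) : Set (V p) := {ξ | ‖qfc p a ξ‖ ^ α ≤ s}

lemma measurableSet_sublevel_prod (hα : 0 ≤ α) :
    MeasurableSet {q : ℝ × V p | q.2 ∈ sublevel a α q.1} := by
  have : Continuous fun q : ℝ × V p => ‖qfc p a q.2‖ ^ α :=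
    (continuous_qfc.comp continuous_snd).norm.rpow_const fun _ => Or.inr hα
  exact (isClosed_le this continuous_fst).measurableSet

lemma measurableSet_sublevel (hα : 0 ≤ α) (s : ℝ) :
    MeasurableSet (sublevel a α s : Set (V p)) :=
  measurable_prodMk_left (x := s) (measurableSet_sublevel_prod (p := p) (a := a) hα)

lemma add_mem_sublevel_iff (ha : IsQNR p a) (hα : 0 ≤ α) {s : ℝ} (η : V p)
    (hη : η ∈ sublevel a α s) (ξ : V p) : η + ξ ∈ sublevel a α s ↔ ξ ∈ sublevel a α s := by
  have key : ∀ ξ η : V p, ξ ∈ sublevel a α s → η ∈ sublevel a α s → ξ + η ∈ sublevel a α s := by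
    intro ξ η hξ hη
    have := Real.rpow_le_rpow (norm_nonneg _) (ha.norm_qfc_add_le ξ η) hα
    refine this.trans ?_
    rcases max_choice ‖qfc p a ξ‖ ‖qfc p a η‖ with h | h <;> rw [h] <;> assumption
  refine ⟨fun h => ?_, key _ _ hη⟩
  have hη' : -η ∈ sublevel a α s := by
    simpa only [sublevel, mem_ofPred_eq, qfc_neg] using hη
  simpa using key _ _ hη' h

lemma closedBall_subset_sublevel (ha : IsQNR p a) (hα : 0 < α) {s : ℝ} (hs : 0 < s) :
    closedBall (0 : V p) (s ^ (1 / (2 * α))) ⊆ sublevel a α s := by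
  intro ξ hξ
  rw [mem_closedBall_zero_iff] at hξ
  calc ‖qfc p a ξ‖ ^ α ≤ ((s ^ (1 / (2 * α))) ^ (2 : ℕ)) ^ α := by
        gcongr
        exact (ha.norm_qfc_le ξ).trans (by gcongr)
    _ = s := by
        rw [← Real.rpow_natCast, ← Real.rpow_mul hs.le, ← Real.rpow_mul hs.le]
        convert Real.rpow_one s using 2
        push_cast
        field_simp

lemma sublevel_subset_closedBall (ha : IsQNR p a) (hα : 0 < α) {s : ℝ} (hs : 0 < s) :
    (sublevel a α s : Set (V p)) ⊆ closedBall 0 (p * (1 + s ^ α⁻¹)) := by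
  intro ξ hξ
  have hp1 := one_lt_prime_cast (p := p)
  have hy : 0 ≤ s ^ α⁻¹ := by positivity
  have h1 : ‖qfc p a ξ‖ ≤ s ^ α⁻¹ := by
    rw [Real.le_rpow_inv_iff_of_pos (norm_nonneg _) hs.le hα]
    exact hξ
  rw [mem_closedBall_zero_iff]
  have h2 := ha.sq_norm_le ξ
  refine (pow_le_pow_iff_left₀ (norm_nonneg _) (by positivity) two_ne_zero).1 ?_
  have h3 : (p : ℝ) * ‖qfc p a ξ‖ ≤ p * s ^ α⁻¹ := by gcongr
  have h4 : 1 ≤ (p : ℝ) * (1 + s ^ α⁻¹) := by nlinarith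
  nlinarith

lemma measure_sublevel_ne_top (ha : IsQNR p a) (hα : 0 < α) {s : ℝ} (hs : 0 < s) :
    μ (sublevel a α s) ≠ ⊤ :=
  ((measure_mono (sublevel_subset_closedBall ha hα hs)).trans_lt
    (isCompact_closedBall _ _).measure_lt_top).ne

lemma integrableOn_exp_mul_measure_sublevel (hμ : μ {x : V p | ‖x‖ ≤ 1} = 1) (ha : IsQNR p a)
    (hα : 0 < α) {τ : ℝ} (hτ : 0 < τ) :
    IntegrableOn (fun s => τ * rexp (-τ * s) * μ.real (sublevel a α s)) (Ioi 0) := by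
  obtain ⟨C, n, hC, h⟩ := exists_measure_closedBall_le hμ
  have hp1 := one_lt_prime_cast (p := p)
  have h0 : IntegrableOn (fun s => rexp (-τ * s)) (Ioi 0) := integrableOn_exp_mul_Ioi (by linarith) 0
  have h1 : IntegrableOn (fun s => s ^ (n / α) * rexp (-τ * s)) (Ioi 0) := by
    have := integrableOn_rpow_mul_exp_neg_mul_rpow (p := 1) (s := n / α)
      (by have : 0 ≤ n / α := by positivity
          linarith) one_pos hτ
    simpa using this
  have hmono : MonotoneOn (fun s => μ.real (sublevel a α s : Set (V p))) (Ioi 0) :=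
    fun s _ s' hs' hss => measureReal_mono (fun ξ hξ => le_trans hξ hss)
      (measure_sublevel_ne_top ha hα hs')
  refine Integrable.mono' ((h0.add h1).const_mul (τ * (C * p ^ n * 2 ^ (n - 1)))) ?_ ?_
  · refine (Continuous.aestronglyMeasurable (by fun_prop)).mul ?_
    exact (aemeasurable_restrict_of_monotoneOn measurableSet_Ioi hmono).aestronglyMeasurable
  · refine (ae_restrict_iff' measurableSet_Ioi).2 (ae_of_all _ fun s hs => ?_)
    have hs : 0 < s := hs
    rw [Real.norm_of_nonneg (by positivity)]
    have hb : μ.real (sublevel a α s) ≤ C * p ^ n * 2 ^ (n - 1) * (1 + s ^ (n / α)) := by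
      calc μ.real (sublevel a α s) ≤ μ.real (closedBall (0 : V p) (p * (1 + s ^ α⁻¹))) :=
            measureReal_mono (sublevel_subset_closedBall ha hα hs)
              (isCompact_closedBall _ _).measure_ne_top
        _ ≤ C * (p * (1 + s ^ α⁻¹)) ^ n := h _ (by
            have : 0 ≤ s ^ α⁻¹ := by positivity
            nlinarith)
        _ = C * p ^ n * (1 + s ^ α⁻¹) ^ n := by rw [mul_pow, mul_assoc]
        _ ≤ C * p ^ n * (2 ^ (n - 1) * (1 ^ n + (s ^ α⁻¹) ^ n)) := by
            gcongr
            exact add_pow_le zero_le_one (by positivity) n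
        _ = C * p ^ n * 2 ^ (n - 1) * (1 + s ^ (n / α)) := by
            rw [one_pow, ← Real.rpow_natCast (s ^ α⁻¹), ← Real.rpow_mul hs.le, inv_mul_eq_div]
            ring
    calc τ * rexp (-τ * s) * μ.real (sublevel a α s)
        ≤ τ * rexp (-τ * s) * (C * p ^ n * 2 ^ (n - 1) * (1 + s ^ (n / α))) := by gcongr
      _ = _ := by simp only [Pi.add_apply]; ring

/-- The heat kernel as a mixture of the Fourier transforms of the sublevel sets. -/
lemma heatZ_eq_integral_charIntegral (hμ : μ {x : V p | ‖x‖ ≤ 1} = 1) (ha : IsQNR p a)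
    (hχ : IsStdChar p χ) (hα : 0 < α) {κ t : ℝ} (hτ : 0 < κ * t) (x : V p) :
    heatZ p μ χ a κ α x t = ∫ s in Ioi (0 : ℝ),
      ((κ * t * rexp (-(κ * t) * s) : ℝ) : ℂ) * charIntegral μ χ (sublevel a α s) x := by
  set τ := κ * t with hτdef
  let F : ℝ → V p → ℂ := fun s => (sublevel a α s).indicator fun ξ =>
    ((τ * rexp (-τ * s) : ℝ) : ℂ) * χ (∑ i, ξ i * x i)
  have hχc := hχ.1
  have hFeq : Function.uncurry F = {q : ℝ × V p | q.2 ∈ sublevel a α q.1}.indicator fun q =>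
      ((τ * rexp (-τ * q.1) : ℝ) : ℂ) * χ (∑ i, q.2 i * x i) := rfl
  have hFm : Measurable (Function.uncurry F) := by
    rw [hFeq]
    exact (Continuous.measurable (by fun_prop)).indicator (measurableSet_sublevel_prod hα.le)
  have hnorm (s : ℝ) (ξ : V p) : ‖F s ξ‖ =
      (sublevel a α s).indicator (fun _ => τ * rexp (-τ * s)) ξ := by
    simp only [F, norm_indicator_eq_indicator_norm, norm_mul, hχ.norm_eq_one, mul_one,
      Complex.norm_real, Real.norm_of_nonneg (show 0 ≤ τ * rexp (-τ * s) by positivity)]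
  have hFint : Integrable (Function.uncurry F) ((volume.restrict (Ioi 0)).prod μ) := by
    rw [integrable_prod_iff hFm.aestronglyMeasurable]
    constructor
    · refine (ae_restrict_iff' measurableSet_Ioi).2 (ae_of_all _ fun s hs => ?_)
      refine (integrable_norm_iff (hFm.comp measurable_prodMk_left).aestronglyMeasurable).1 ?_
      change Integrable (fun ξ => ‖F s ξ‖) μ
      simp only [hnorm]
      rw [integrable_indicator_iff (measurableSet_sublevel hα.le s)]
      exact integrableOn_const (measure_sublevel_ne_top ha hα hs)
    · refine (integrableOn_exp_mul_measure_sublevel hμ ha hα hτ).congr (ae_of_all _ fun s => ?_)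
      change _ = ∫ ξ, ‖F s ξ‖ ∂μ
      simp only [hnorm]
      rw [integral_indicator (measurableSet_sublevel hα.le s), setIntegral_const, smul_eq_mul,
        mul_comm]
  have hswap := integral_integral_swap hFint
  have hleft (s : ℝ) : ∫ ξ, F s ξ ∂μ =
      ((τ * rexp (-τ * s) : ℝ) : ℂ) * charIntegral μ χ (sublevel a α s) x := by
    rw [integral_indicator (measurableSet_sublevel hα.le s), integral_const_mul, charIntegral]
  have hright (ξ : V p) : ∫ s in Ioi (0 : ℝ), F s ξ =
      χ (∑ i, ξ i * x i) * (rexp (-(τ * ‖qfc p a ξ‖ ^ α)) : ℂ) := by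
    have hv : 0 ≤ ‖qfc p a ξ‖ ^ α := by positivity
    set v := ‖qfc p a ξ‖ ^ α with hvdef
    have : (fun s => F s ξ) = (Ici v).indicator
        fun s => ((τ * rexp (-τ * s) : ℝ) : ℂ) * χ (∑ i, ξ i * x i) := by
      ext s; rfl
    rw [this, setIntegral_indicator measurableSet_Ici,
      setIntegral_congr_set (t := Ioi v), integral_mul_const, integral_complex_ofReal,
      integral_const_mul, integral_exp_mul_Ioi (by linarith)]
    · rw [mul_comm]
      congr 2
      field_simp
    · have h := (ae_eq_refl (μ := volume) (Ioi (0 : ℝ))).inter (Ioi_ae_eq_Ici (a := v)).symm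
      rwa [Ioi_inter_Ioi, sup_eq_right.2 hv] at h
  simp only [hleft, hright] at hswap
  rw [hswap]
  simp only [heatZ, hτdef, Complex.ofReal_exp]

end

/-- The Abel means of a function that is eventually constant converge to that constant. -/
lemma tendsto_integral_exp_mul {A : ℝ → ℂ} {c : ℂ} {S : ℝ}
    (hc : ∀ s, S ≤ s → A s = c) (hA : IntegrableOn A (Ioc 0 S)) :
    Tendsto (fun τ : ℝ => ∫ s in Ioi (0 : ℝ), ((τ * rexp (-τ * s) : ℝ) : ℂ) * A s)
      (nhdsWithin 0 (Ioi 0)) (nhds c) := by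
  set B : ℝ → ℂ := fun s => A s - c
  have hB : IntegrableOn B (Ioc 0 S) := hA.sub (integrableOn_const (by simp))
  have hB0 : ∀ s ∈ Ioi (0 : ℝ) \ Ioc 0 S, B s = 0 := by
    rintro s ⟨hs, hs'⟩
    have : S < s := not_le.1 fun h => hs' ⟨hs, h⟩
    simp only [B, hc s this.le, sub_self]
  have key : ∀ τ : ℝ, 0 < τ →
      ‖(∫ s in Ioi (0 : ℝ), ((τ * rexp (-τ * s) : ℝ) : ℂ) * A s) - c‖ ≤
        τ * ∫ s in Ioc 0 S, ‖B s‖ := by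
    intro τ hτ
    have hw : IntegrableOn (fun s => ((τ * rexp (-τ * s) : ℝ) : ℂ)) (Ioi 0) :=
      ((integrableOn_exp_mul_Ioi (by linarith) 0).const_mul τ).ofReal
    have hw1 : ∫ s in Ioi (0 : ℝ), ((τ * rexp (-τ * s) : ℝ) : ℂ) = 1 := by
      rw [integral_complex_ofReal, integral_const_mul, integral_exp_mul_Ioi (by linarith)]
      simp [hτ.ne']
    have hle : ∀ s ∈ Ioc 0 S, ‖((τ * rexp (-τ * s) : ℝ) : ℂ) * B s‖ ≤ τ * ‖B s‖ := by
      intro s hs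
      rw [norm_mul, Complex.norm_real, Real.norm_of_nonneg (by positivity)]
      gcongr
      exact mul_le_of_le_one_right hτ.le (Real.exp_le_one_iff.2 (by nlinarith [hs.1]))
    have hwB : IntegrableOn (fun s => ((τ * rexp (-τ * s) : ℝ) : ℂ) * B s) (Ioc 0 S) := by
      refine Integrable.mono' (hB.norm.const_mul τ) ?_
        ((ae_restrict_iff' measurableSet_Ioc).2 (ae_of_all _ hle))
      exact (Continuous.aestronglyMeasurable (by fun_prop)).mul hB.aestronglyMeasurable
    have hwB' : IntegrableOn (fun s => ((τ * rexp (-τ * s) : ℝ) : ℂ) * B s) (Ioi 0) :=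
      hwB.of_forall_sdiff_eq_zero measurableSet_Ioi fun s hs => by rw [hB0 s hs, mul_zero]
    have hsplit : ∫ s in Ioi (0 : ℝ), ((τ * rexp (-τ * s) : ℝ) : ℂ) * A s =
        (∫ s in Ioi (0 : ℝ), ((τ * rexp (-τ * s) : ℝ) : ℂ) * B s) + c := by
      rw [show c = ∫ s in Ioi (0 : ℝ), ((τ * rexp (-τ * s) : ℝ) : ℂ) * c by
        rw [integral_mul_const, hw1, one_mul], ← integral_add hwB' (hw.mul_const c)]
      congr 1 with s
      simp only [B]
      ring
    have hcut : ∫ s in Ioi (0 : ℝ), ((τ * rexp (-τ * s) : ℝ) : ℂ) * B s =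
        ∫ s in Ioc 0 S, ((τ * rexp (-τ * s) : ℝ) : ℂ) * B s :=
      setIntegral_eq_of_subset_of_forall_sdiff_eq_zero measurableSet_Ioi Ioc_subset_Ioi_self
        fun s hs => by rw [hB0 s hs, mul_zero]
    rw [hsplit, add_sub_cancel_right, hcut, ← integral_const_mul]
    exact norm_integral_le_of_norm_le (hB.norm.const_mul τ)
      ((ae_restrict_iff' measurableSet_Ioc).2 (ae_of_all _ hle))
  rw [tendsto_iff_norm_sub_tendsto_zero]
  refine squeeze_zero' (Eventually.of_forall fun _ => norm_nonneg _)
    (eventually_nhdsWithin_of_forall key) ?_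
  have : Tendsto (fun τ : ℝ => τ * ∫ s in Ioc 0 S, ‖B s‖) (nhds 0)
      (nhds (0 * ∫ s in Ioc 0 S, ‖B s‖)) := tendsto_id.mul_const _
  rw [zero_mul] at this
  exact this.mono_left nhdsWithin_le_nhds

section
variable {p} {a : ℤ} {α : ℝ}
variable {μ : Measure (V p)} [μ.IsAddHaarMeasure] {χ : ℚ_[p] → ℂ}

open Metric

lemma measurable_charIntegral_sublevel (hχ : IsStdChar p χ) (hα : 0 ≤ α) :
    Measurable fun q : ℝ × V p => charIntegral μ χ (sublevel a α q.1) q.2 := by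
  have hχc := hχ.1
  have hm : Measurable fun r : (ℝ × V p) × V p =>
      (sublevel a α r.1.1).indicator (fun ξ => χ (∑ i, ξ i * r.1.2 i)) r.2 := by
    have hset : MeasurableSet {r : (ℝ × V p) × V p | r.2 ∈ sublevel a α r.1.1} :=
      (measurable_fst.fst.prodMk measurable_snd) (measurableSet_sublevel_prod hα)
    exact (Continuous.measurable (by fun_prop :
      Continuous fun r : (ℝ × V p) × V p => χ (∑ i, r.2 i * r.1.2 i))).indicator hset
  have := StronglyMeasurable.integral_prod_right (ν := μ)
    (f := fun (q : ℝ × V p) ξ => (sublevel a α q.1).indicator (fun ξ => χ (∑ i, ξ i * q.2 i)) ξ)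
    hm.stronglyMeasurable
  simp only [integral_indicator (measurableSet_sublevel hα _)] at this
  exact this.measurable

lemma integral_charIntegral_sublevel (hμ : μ {x : V p | ‖x‖ ≤ 1} = 1) (ha : IsQNR p a)
    (hχ : IsStdChar p χ) (hα : 0 < α) {s : ℝ} (hs : 0 < s) (x : V p) :
    ∫ ξ, charIntegral μ χ (sublevel a α s) (x - ξ) ∂μ = 1 := by
  rw [integral_sub_left_eq_self (fun ξ => charIntegral μ χ (sublevel a α s) ξ) μ x]
  exact integral_charIntegral hμ hχ (measurableSet_sublevel hα.le s)
    (add_mem_sublevel_iff ha hα.le) (by positivity) (closedBall_subset_sublevel ha hα hs)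
    (measure_sublevel_ne_top ha hα hs)

lemma integral_norm_charIntegral_sublevel (hμ : μ {x : V p | ‖x‖ ≤ 1} = 1) (ha : IsQNR p a)
    (hχ : IsStdChar p χ) (hα : 0 < α) {s : ℝ} (hs : 0 < s) (x : V p) :
    ∫ ξ, ‖charIntegral μ χ (sublevel a α s) (x - ξ)‖ ∂μ = 1 := by
  have h := integral_charIntegral_sublevel hμ ha hχ hα hs x
  rw [← integral_congr_ae (ae_of_all _ fun ξ => ofReal_norm_charIntegral hχ
    (measurableSet_sublevel hα.le s) (add_mem_sublevel_iff ha hα.le) (x - ξ)),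
    integral_complex_ofReal] at h
  exact_mod_cast h

/-- The averages of `φ` against the kernel `charIntegral μ χ (sublevel a α s)`. -/
def average (μ : Measure (V p)) (χ : ℚ_[p] → ℂ) (a : ℤ) (α : ℝ) (φ : V p → ℂ) (x : V p)
    (s : ℝ) : ℂ :=
  ∫ ξ, charIntegral μ χ (sublevel a α s) (x - ξ) * φ ξ ∂μ

lemma norm_sub_lt_of_charIntegral_ne_zero (ha : IsQNR p a)
    (hχ : IsStdChar p χ) (hα : 0 < α) {s : ℝ} (hs : 0 < s) {y : V p}
    (h : charIntegral μ χ (sublevel a α s) y ≠ 0) : ‖y‖ < p / s ^ (1 / (2 * α)) := by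
  contrapose! h
  exact charIntegral_eq_zero_of_le hχ (measurableSet_sublevel hα.le s)
    (add_mem_sublevel_iff ha hα.le) (by positivity) (closedBall_subset_sublevel ha hα hs) h

lemma average_eq (hμ : μ {x : V p | ‖x‖ ≤ 1} = 1) (ha : IsQNR p a)
    (hχ : IsStdChar p χ) (hα : 0 < α) {φ : V p → ℂ} (hφ : IsLocallyConstant φ) (x : V p) :
    ∃ S, ∀ s, S ≤ s → average μ χ a α φ x s = φ x := by
  have hp0 := prime_cast_pos (p := p)
  obtain ⟨δ, hδ, h⟩ := Metric.eventually_nhds_iff.1 (hφ.eventually_eq x)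
  refine ⟨(p / δ) ^ (2 * α), fun s hs => ?_⟩
  have hs0 : 0 < s := lt_of_lt_of_le (by positivity) hs
  have hR : p / s ^ (1 / (2 * α)) ≤ δ := by
    have : p / δ ≤ s ^ (2 * α)⁻¹ := by
      rwa [Real.le_rpow_inv_iff_of_pos (by positivity) hs0.le (by positivity)]
    rw [div_le_iff₀ hδ] at this
    rw [one_div, div_le_iff₀ (by positivity)]
    linarith
  have : ∀ ξ, charIntegral μ χ (sublevel a α s) (x - ξ) * φ ξ =
      charIntegral μ χ (sublevel a α s) (x - ξ) * φ x := by
    intro ξ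
    by_cases h0 : charIntegral μ χ (sublevel a α s) (x - ξ) = 0
    · rw [h0, zero_mul, zero_mul]
    · rw [h]
      rw [dist_comm, dist_eq_norm]
      exact (norm_sub_lt_of_charIntegral_ne_zero ha hχ hα hs0 h0).trans_le hR
  simp only [average, this]
  rw [integral_mul_const, integral_charIntegral_sublevel hμ ha hχ hα hs0, one_mul]

/-- The growth bound for the averages of a function in `𝔐_{2λ}`. -/
lemma exists_bound_charIntegral_mul (ha : IsQNR p a)
    (hχ : IsStdChar p χ) (hα : 0 < α) {lam : ℝ} (hlam : 0 ≤ lam) {φ : V p → ℂ}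
    (hφ : Mlam p (2 * lam) φ) (x : V p) :
    ∃ C₀ C₁ : ℝ, 0 ≤ C₀ ∧ 0 ≤ C₁ ∧ ∀ s : ℝ, 0 < s → ∀ ξ,
      ‖charIntegral μ χ (sublevel a α s) (x - ξ) * φ ξ‖ ≤
        (C₀ + C₁ * s ^ (-(lam / α))) * ‖charIntegral μ χ (sublevel a α s) (x - ξ)‖ := by
  have hp0 := prime_cast_pos (p := p)
  obtain ⟨-, C, hC⟩ := hφ
  have hC0 : 0 ≤ C := by
    have := (norm_nonneg _).trans (hC 0)
    exact nonneg_of_mul_nonneg_left this (by positivity)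
  refine ⟨C * (1 + ‖x‖ ^ (2 * lam)), C * (p : ℝ) ^ (2 * lam), by positivity, by positivity,
    fun s hs ξ => ?_⟩
  rw [norm_mul, mul_comm]
  by_cases h0 : charIntegral μ χ (sublevel a α s) (x - ξ) = 0
  · simp [h0]
  have hlt := norm_sub_lt_of_charIntegral_ne_zero ha hχ hα hs h0
  gcongr
  have hξ : ‖ξ‖ ≤ max ‖x‖ (p / s ^ (1 / (2 * α))) := by
    have := IsUltrametricDist.norm_add_le_max x (-(x - ξ))
    rw [norm_neg, ← sub_eq_add_neg, sub_sub_cancel] at this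
    exact this.trans (max_le_max le_rfl hlt.le)
  have hpow : ‖ξ‖ ^ (2 * lam) ≤ ‖x‖ ^ (2 * lam) + (p / s ^ (1 / (2 * α))) ^ (2 * lam) := by
    have h1 : 0 ≤ ‖x‖ ^ (2 * lam) := by positivity
    have h2 : 0 ≤ (p / s ^ (1 / (2 * α))) ^ (2 * lam) := by positivity
    rcases le_max_iff.1 hξ with h | h
    · have := Real.rpow_le_rpow (norm_nonneg _) h (by positivity : 0 ≤ 2 * lam)
      linarith
    · have := Real.rpow_le_rpow (norm_nonneg _) h (by positivity : 0 ≤ 2 * lam)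
      linarith
  have hR : (p / s ^ (1 / (2 * α))) ^ (2 * lam) = (p : ℝ) ^ (2 * lam) * s ^ (-(lam / α)) := by
    rw [Real.div_rpow hp0.le (by positivity), ← Real.rpow_mul hs.le, Real.rpow_neg hs.le,
      div_eq_mul_inv]
    congr 3
    field_simp
  rw [hR] at hpow
  calc ‖φ ξ‖ ≤ C * (1 + ‖ξ‖ ^ (2 * lam)) := hC ξ
    _ ≤ C * (1 + (‖x‖ ^ (2 * lam) + (p : ℝ) ^ (2 * lam) * s ^ (-(lam / α)))) := by gcongr
    _ = _ := by ring

lemma measurable_charIntegral_mul (hχ : IsStdChar p χ) (hα : 0 ≤ α) {φ : V p → ℂ}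
    (hφ : IsLocallyConstant φ) (x : V p) :
    Measurable fun q : ℝ × V p => charIntegral μ χ (sublevel a α q.1) (x - q.2) * φ q.2 :=
  ((measurable_charIntegral_sublevel hχ hα).comp
    (measurable_fst.prodMk (measurable_snd.const_sub x))).mul
    (hφ.continuous.measurable.comp measurable_snd)

lemma integrable_charIntegral_mul (hμ : μ {x : V p | ‖x‖ ≤ 1} = 1) (ha : IsQNR p a)
    (hχ : IsStdChar p χ) (hα : 0 < α) {φ : V p → ℂ} (hφ : IsLocallyConstant φ) {x : V p}
    {s M : ℝ} (hs : 0 < s)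
    (hM : ∀ ξ, ‖charIntegral μ χ (sublevel a α s) (x - ξ) * φ ξ‖ ≤
      M * ‖charIntegral μ χ (sublevel a α s) (x - ξ)‖) :
    Integrable (fun ξ => charIntegral μ χ (sublevel a α s) (x - ξ) * φ ξ) μ ∧
      ∫ ξ, ‖charIntegral μ χ (sublevel a α s) (x - ξ) * φ ξ‖ ∂μ ≤ M := by
  have h1 := integral_norm_charIntegral_sublevel hμ ha hχ hα hs x
  have hi := (integrable_of_integral_eq_one h1).const_mul M
  have hint : Integrable (fun ξ => charIntegral μ χ (sublevel a α s) (x - ξ) * φ ξ) μ :=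
    hi.mono' ((measurable_charIntegral_mul hχ hα.le hφ x).comp
      measurable_prodMk_left).aestronglyMeasurable (ae_of_all _ hM)
  refine ⟨hint, (integral_mono hint.norm hi hM).trans ?_⟩
  rw [integral_const_mul, h1, mul_one]

lemma integrableOn_average (hμ : μ {x : V p | ‖x‖ ≤ 1} = 1) (ha : IsQNR p a)
    (hχ : IsStdChar p χ) (hα : 0 < α) {lam : ℝ} (hlam0 : 0 ≤ lam) (hlam : lam < α)
    {φ : V p → ℂ} (hφ : Mlam p (2 * lam) φ) (x : V p) (S : ℝ) :
    IntegrableOn (average μ χ a α φ x) (Ioc 0 S) := by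
  obtain ⟨C₀, C₁, hC₀, hC₁, hM⟩ := exists_bound_charIntegral_mul (μ := μ) ha hχ hα hlam0 hφ x
  have hβ : -1 < -(lam / α) := by
    rw [neg_lt_neg_iff, div_lt_one hα]; exact hlam
  have hrpow : IntegrableOn (fun s : ℝ => s ^ (-(lam / α))) (Ioc 0 S) := by
    rcases le_total 0 S with hS | hS
    · rw [← intervalIntegrable_iff_integrableOn_Ioc_of_le hS]
      exact intervalIntegral.intervalIntegrable_rpow' hβ
    · rw [Ioc_eq_empty (not_lt.2 hS)]; exact integrableOn_empty
  refine Integrable.mono' ((integrableOn_const (C := C₀) (by simp)).add (hrpow.const_mul C₁)) ?_ ?_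
  · exact (StronglyMeasurable.integral_prod_right
      (f := fun s ξ => charIntegral μ χ (sublevel a α s) (x - ξ) * φ ξ)
      (measurable_charIntegral_mul hχ hα.le hφ.1 x).stronglyMeasurable).aestronglyMeasurable
  · refine (ae_restrict_iff' measurableSet_Ioc).2 (ae_of_all _ fun s hs => ?_)
    exact (norm_integral_le_integral_norm _).trans
      (integrable_charIntegral_mul hμ ha hχ hα hφ.1 hs.1 (hM s hs.1)).2

lemma integral_heatZ_mul (hμ : μ {x : V p | ‖x‖ ≤ 1} = 1) (ha : IsQNR p a)
    (hχ : IsStdChar p χ) (hα : 0 < α) {lam : ℝ} (hlam0 : 0 ≤ lam) (hlam : lam < α)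
    {φ : V p → ℂ} (hφ : Mlam p (2 * lam) φ) (x : V p) {κ t : ℝ} (hτ : 0 < κ * t) :
    ∫ ξ, heatZ p μ χ a κ α (x - ξ) t * φ ξ ∂μ =
      ∫ s in Ioi (0 : ℝ), ((κ * t * rexp (-(κ * t) * s) : ℝ) : ℂ) * average μ χ a α φ x s := by
  obtain ⟨C₀, C₁, hC₀, hC₁, hM⟩ := exists_bound_charIntegral_mul (μ := μ) ha hχ hα hlam0 hφ x
  have hβ : -1 < -(lam / α) := by
    rw [neg_lt_neg_iff, div_lt_one hα]; exact hlam
  simp only [heatZ_eq_integral_charIntegral hμ ha hχ hα hτ, ← integral_mul_const, average,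
    ← integral_const_mul, ← mul_assoc]
  set τ := κ * t
  symm
  apply integral_integral_swap
  have hmeas : Measurable fun q : ℝ × V p => ((τ * rexp (-τ * q.1) : ℝ) : ℂ) *
      charIntegral μ χ (sublevel a α q.1) (x - q.2) * φ q.2 := by
    simp only [mul_assoc]
    refine Measurable.mul (Continuous.measurable (by fun_prop)) ?_
    exact measurable_charIntegral_mul hχ hα.le hφ.1 x
  refine (integrable_prod_iff hmeas.aestronglyMeasurable).2 ⟨?_, ?_⟩
  · refine (ae_restrict_iff' measurableSet_Ioi).2 (ae_of_all _ fun s hs => ?_)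
    simp only [mul_assoc ((τ * rexp (-τ * s) : ℝ) : ℂ)]
    exact (integrable_charIntegral_mul hμ ha hχ hα hφ.1 hs (hM s hs)).1.const_mul _
  · have h0 : IntegrableOn (fun s => rexp (-τ * s)) (Ioi 0) :=
      integrableOn_exp_mul_Ioi (by linarith) 0
    have h1 : IntegrableOn (fun s => s ^ (-(lam / α)) * rexp (-τ * s)) (Ioi 0) := by
      simpa using integrableOn_rpow_mul_exp_neg_mul_rpow (p := 1) hβ one_pos hτ
    refine Integrable.mono' ((h0.const_mul (τ * C₀)).add (h1.const_mul (τ * C₁))) ?_ ?_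
    · exact (StronglyMeasurable.integral_prod_right (f := fun s ξ =>
        ‖((τ * rexp (-τ * s) : ℝ) : ℂ) * charIntegral μ χ (sublevel a α s) (x - ξ) * φ ξ‖)
        hmeas.norm.stronglyMeasurable).aestronglyMeasurable
    · refine (ae_restrict_iff' measurableSet_Ioi).2 (ae_of_all _ fun s hs => ?_)
      have hw : 0 ≤ τ * rexp (-τ * s) := by positivity
      change ‖∫ ξ, ‖((τ * rexp (-τ * s) : ℝ) : ℂ) *
        charIntegral μ χ (sublevel a α s) (x - ξ) * φ ξ‖ ∂μ‖ ≤ _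
      simp only [mul_assoc ((τ * rexp (-τ * s) : ℝ) : ℂ), norm_mul ((τ * rexp (-τ * s) : ℝ) : ℂ),
        Complex.norm_real, Real.norm_of_nonneg hw]
      rw [integral_const_mul, norm_mul, Real.norm_of_nonneg hw,
        Real.norm_of_nonneg (integral_nonneg fun _ => norm_nonneg _)]
      refine (mul_le_mul_of_nonneg_left
        (integrable_charIntegral_mul hμ ha hχ hα hφ.1 hs (hM s hs)).2 hw).trans_eq ?_
      simp only [Pi.add_apply]
      ring

end

/-- for `0 ≤ λ < α` and `φ ∈ 𝔐_{2λ}`,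
`lim_{t→0⁺} ∫ Z(x − ξ, t) φ(ξ) d⁴ξ = φ(x)` for every `x`. -/
theorem statement8
    (hp : p ≠ 2) (a : ℤ) (ha : IsQNR p a)
    (μ : Measure (V p)) [μ.IsAddHaarMeasure] (hμ : μ {x : V p | ‖x‖ ≤ 1} = 1)
    (χ : ℚ_[p] → ℂ) (hχ : IsStdChar p χ)
    (κ α lam : ℝ) (hκ : 0 < κ) (hα : 0 < α) (hlam0 : 0 ≤ lam) (hlam : lam < α)
    (φ : V p → ℂ) (hφ : Mlam p (2 * lam) φ) (x : V p) :
    Tendsto (fun t : ℝ => ∫ ξ, heatZ p μ χ a κ α (x - ξ) t * φ ξ ∂μ)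
      (nhdsWithin 0 (Set.Ioi 0)) (nhds (φ x)) := by
  have hτ : Tendsto (fun t : ℝ => κ * t) (nhdsWithin 0 (Ioi 0)) (nhdsWithin 0 (Ioi 0)) := by
    refine tendsto_nhdsWithin_iff.2 ⟨?_, eventually_nhdsWithin_of_forall fun t ht => mul_pos hκ ht⟩
    have : Tendsto (fun t : ℝ => κ * t) (nhds 0) (nhds (κ * 0)) := tendsto_id.const_mul κ
    rw [mul_zero] at this
    exact this.mono_left nhdsWithin_le_nhds
  obtain ⟨S, hS⟩ := average_eq hμ ha hχ hα hφ.1 x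
  refine ((tendsto_integral_exp_mul hS
    (integrableOn_average hμ ha hχ hα hlam0 hlam hφ x S)).comp hτ).congr' ?_
  refine eventually_nhdsWithin_of_forall fun t ht => ?_
  exact (integral_heatZ_mul hμ ha hχ hα hlam0 hlam hφ x (mul_pos hκ ht)).symm

end PadicParabolic
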